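/- arXiv:2007.01410 — 8 statements merged into one kernel-verified Lean document; each statement's English description precedes it below -/
import Mathlib

section
/- For all real numbers n > 0 and α > 0, and for every real t ≥ 1, one has (1 - 1/t)^n · t^{-α} ≤ (α/e)^α · n^{-α}. -/
/-- Lemma 2 (paper Lemma `lem1`): for `n > 0`, `α > 0` and `t ≥ 1`,
`(1 - 1/t)^n * t^(-α) ≤ (α/e)^α * n^(-α)`, all powers being real powers. -/
theorem weighted_cayley_lem1 (n α t : ℝ) (hn : 0 < n) (hα : 0 < α) (ht : 1 ≤ t) :
    (1 - 1 / t) ^ n * t ^ (-α) ≤ (α / Real.exp 1) ^ α * n ^ (-α) := by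
  have ht0 : 0 < t := by linarith
  have hbase : 0 ≤ 1 - 1 / t := by
    rw [sub_nonneg, div_le_one ht0]
    exact ht
  have hexp : (1 - 1 / t) ^ n ≤ Real.exp (-(n / t)) := by
    calc (1 - 1 / t) ^ n ≤ Real.exp (-(1 / t)) ^ n :=
          Real.rpow_le_rpow hbase (Real.one_sub_le_exp_neg _) hn.le
      _ = Real.exp (-(n / t)) := by
          rw [← Real.exp_mul]
          congr 1
          ring
  have hlog : Real.log n - (Real.log t + Real.log α) ≤ n / (t * α) - 1 := by
    rw [← Real.log_mul ht0.ne' hα.ne', ← Real.log_div hn.ne' (by positivity)]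
    exact Real.log_le_sub_one_of_pos (by positivity)
  have hmul : n / (t * α) * α = n / t := by field_simp
  calc (1 - 1 / t) ^ n * t ^ (-α) ≤ Real.exp (-(n / t)) * t ^ (-α) := by gcongr
    _ = Real.exp (-(n / t) + Real.log t * -α) := by
        rw [Real.rpow_def_of_pos ht0, Real.exp_add]
    _ ≤ Real.exp ((Real.log α - 1) * α + Real.log n * -α) := by
        apply Real.exp_le_exp.mpr
        linarith [mul_le_mul_of_nonneg_right hlog hα.le]
    _ = (α / Real.exp 1) ^ α * n ^ (-α) := by
        rw [Real.rpow_def_of_pos (by positivity), Real.rpow_def_of_pos hn,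
          Real.log_div hα.ne' (Real.exp_ne_zero 1), Real.log_exp, Real.exp_add]
end

section
/- Let k ≥ 1 be a natural number. Then the supremum over t ≥ 0 of the function g(t) = [ t / ((t/k + 1)(t + 1)) ]^k is attained at t = √k, its value equals (1 + 1/√k)^{-2k}, and moreover (1 + 1/√k)^{-2k} ≤ e · e^{-2√k}. -/
theorem div_self_mul_eq_inv_sq {s : ℝ} (hs : 0 < s) :
    s / ((1 / s + 1) * (s + 1)) = ((1 + 1 / s) ^ 2)⁻¹ := by
  field_simp
  ring

theorem div_mul_le_inv_sq {s t : ℝ} (hs : 0 < s) (ht : 0 ≤ t) :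
    t / ((t / s ^ 2 + 1) * (t + 1)) ≤ ((1 + 1 / s) ^ 2)⁻¹ := by
  rw [inv_eq_one_div, div_le_div_iff₀ (by positivity) (by positivity), ← sub_nonneg]
  have h : 1 * ((t / s ^ 2 + 1) * (t + 1)) - t * (1 + 1 / s) ^ 2 = ((t - s) / s) ^ 2 := by
    field_simp
    ring
  rw [h]
  positivity

theorem sub_sq_div_two_le_log_one_add {x : ℝ} (hx : 0 ≤ x) :
    x - x ^ 2 / 2 ≤ Real.log (1 + x) := by
  refine le_trans ?_ (Real.le_log_one_add_of_nonneg hx)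
  rw [le_div_iff₀ (by positivity)]
  nlinarith [pow_nonneg hx 3]

/-- Lemma (paper Lemma `lem3`): for a natural number `k ≥ 1`, the function
`g(t) = [t / ((t/k + 1)(t + 1))]^k` on `t ≥ 0` attains its supremum at `t = √k`,
its maximal value equals `(1 + 1/√k)^(-2k)`, and this value is at most `e·e^(-2√k)`. -/
theorem weighted_cayley_lem3 (k : ℕ) (hk : 1 ≤ k) :
    (∀ t : ℝ, 0 ≤ t →
      (t / ((t / k + 1) * (t + 1))) ^ k ≤
        (Real.sqrt k / ((1 / Real.sqrt k + 1) * (Real.sqrt k + 1))) ^ k) ∧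
    (Real.sqrt k / ((1 / Real.sqrt k + 1) * (Real.sqrt k + 1))) ^ k
      = (1 + 1 / Real.sqrt k) ^ (-(2 * (k : ℤ))) ∧
    (1 + 1 / Real.sqrt k : ℝ) ^ (-(2 * (k : ℤ))) ≤
      Real.exp 1 * Real.exp (-2 * Real.sqrt k) := by
  have hk0 : (0 : ℝ) < k := by exact_mod_cast hk
  have hs : 0 < √(k : ℝ) := Real.sqrt_pos.2 hk0
  have hsq : √(k : ℝ) ^ 2 = k := Real.sq_sqrt hk0.le
  refine ⟨fun t ht => ?_, ?_, ?_⟩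
  · rw [div_self_mul_eq_inv_sq hs]
    have h := div_mul_le_inv_sq hs ht
    rw [hsq] at h
    exact pow_le_pow_left₀ (by positivity) h k
  · rw [div_self_mul_eq_inv_sq hs, zpow_neg, zpow_mul, zpow_natCast, inv_pow]
    norm_cast
  · have hlog := sub_sq_div_two_le_log_one_add (x := 1 / √(k : ℝ)) (by positivity)
    have hpos : 0 < 1 + 1 / √(k : ℝ) := by positivity
    rw [← Real.exp_add, ← Real.log_le_iff_le_exp (zpow_pos hpos _), Real.log_zpow]
    push_cast
    have hmul := mul_le_mul_of_nonneg_left hlog (by positivity : (0 : ℝ) ≤ 2 * k)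
    have heq : 2 * (k : ℝ) * (1 / √(k : ℝ) - (1 / √(k : ℝ)) ^ 2 / 2) = 2 * √(k : ℝ) - 1 := by
      nth_rewrite 1 [← hsq]
      field_simp
    linarith
end

section
/- For every natural number k ≥ 1 and every x ∈ [0,1], the polynomial v_k satisfies v_k(x) = Σ_{p=1}^{∞} (2(-1)^p/(pπ)³) · (1 - 1/(pπ)²)^{k-1} · sin(pπx), the series on the right-hand side converging absolutely. -/
/-- The Green function `G₀` of `Lv = -v''` on `(0,1)` with `v(0) = v(1) = 0`. -/
noncomputable def G0 (x ξ : ℝ) : ℝ := if x ≤ ξ then x * (1 - ξ) else ξ * (1 - x)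

lemma G0_eq_min_mul (x ξ : ℝ) : G0 x ξ = min x ξ * (1 - max x ξ) := by
  unfold G0
  split_ifs with h
  · rw [min_eq_left h, max_eq_right h]
  · rw [min_eq_right (le_of_not_ge h), max_eq_left (le_of_not_ge h)]

lemma continuous_G0 (x : ℝ) : Continuous (G0 x) := by
  have h : G0 x = fun ξ => min x ξ * (1 - max x ξ) := funext (G0_eq_min_mul x)
  rw [h]
  fun_prop

lemma abs_G0_le_one {x ξ : ℝ} (hx : x ∈ Set.Icc (0 : ℝ) 1) (hξ : ξ ∈ Set.Icc (0 : ℝ) 1) :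
    |G0 x ξ| ≤ 1 := by
  obtain ⟨hx0, hx1⟩ := hx
  obtain ⟨hξ0, hξ1⟩ := hξ
  unfold G0
  split_ifs <;> exact abs_le.2 ⟨by nlinarith, by nlinarith⟩

/-- The sine with frequency `c`, vanishing at the endpoint `1`, is an eigenfunction of the
Green operator. -/
lemma integral_G0_mul_sin {c x : ℝ} (hc : c ≠ 0) (hsin : Real.sin c = 0)
    (hx : x ∈ Set.Icc (0 : ℝ) 1) :
    ∫ ξ in (0 : ℝ)..1, G0 x ξ * Real.sin (c * ξ) = Real.sin (c * x) / c ^ 2 := by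
  have hcont : Continuous fun ξ => G0 x ξ * Real.sin (c * ξ) :=
    (continuous_G0 x).mul (by fun_prop)
  have hs (t : ℝ) : HasDerivAt (fun ξ => Real.sin (c * ξ)) (Real.cos (c * t) * c) t := by
    simpa using ((hasDerivAt_id t).const_mul c).sin
  have hk (t : ℝ) : HasDerivAt (fun ξ => Real.cos (c * ξ)) (-Real.sin (c * t) * c) t := by
    simpa using ((hasDerivAt_id t).const_mul c).cos
  have hleft : ∫ ξ in (0 : ℝ)..x, G0 x ξ * Real.sin (c * ξ) =
      (1 - x) * (Real.sin (c * x) / c ^ 2 - x * Real.cos (c * x) / c) := by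
    have h := intervalIntegral.integral_eq_sub_of_hasDerivAt
      (f := fun ξ => (1 - x) * (Real.sin (c * ξ) / c ^ 2 - ξ * Real.cos (c * ξ) / c))
      (f' := fun ξ => ξ * (1 - x) * Real.sin (c * ξ)) (a := 0) (b := x)
      (fun t _ => by
        convert! (((hs t).div_const (c ^ 2)).sub
          (((hasDerivAt_id t).mul (hk t)).div_const c)).const_mul (1 - x) using 1
        simp only [id]
        field_simp
        ring) (Continuous.intervalIntegrable (by fun_prop) _ _)
    rw [intervalIntegral.integral_congr (g := fun ξ => ξ * (1 - x) * Real.sin (c * ξ)), h]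
    · simp
    · intro ξ hξ
      rw [Set.uIcc_of_le hx.1] at hξ
      simp only [G0_eq_min_mul, min_eq_right hξ.2, max_eq_left hξ.2]
  have hright : ∫ ξ in x..1, G0 x ξ * Real.sin (c * ξ) =
      x * (Real.sin (c * x) / c ^ 2 + (1 - x) * Real.cos (c * x) / c) := by
    have h := intervalIntegral.integral_eq_sub_of_hasDerivAt
      (f := fun ξ => -x * (Real.sin (c * ξ) / c ^ 2 + (1 - ξ) * Real.cos (c * ξ) / c))
      (f' := fun ξ => x * (1 - ξ) * Real.sin (c * ξ)) (a := x) (b := 1)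
      (fun t _ => by
        convert! (((hs t).div_const (c ^ 2)).add
          ((((hasDerivAt_id t).const_sub 1).mul (hk t)).div_const c)).const_mul (-x) using 1
        simp only [id]
        field_simp
        ring) (Continuous.intervalIntegrable (by fun_prop) _ _)
    rw [intervalIntegral.integral_congr (g := fun ξ => x * (1 - ξ) * Real.sin (c * ξ)), h]
    · simp [hsin]
    · intro ξ hξ
      rw [Set.uIcc_of_le hx.2] at hξ
      simp only [G0_eq_min_mul, min_eq_left hξ.1, max_eq_right hξ.1]
  rw [← intervalIntegral.integral_add_adjacent_intervals (b := x)
    (hcont.intervalIntegrable _ _) (hcont.intervalIntegrable _ _), hleft, hright]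
  ring

/-- The Green operator acts diagonally on absolutely convergent sine series. -/
lemma hasSum_integral_G0_mul {a : ℕ → ℝ} (ha : Summable fun p => |a p|) {w : ℝ → ℝ}
    (hw : ∀ ξ ∈ Set.Icc (0 : ℝ) 1,
      HasSum (fun p : ℕ => a p * Real.sin (((p : ℝ) + 1) * Real.pi * ξ)) (w ξ))
    {x : ℝ} (hx : x ∈ Set.Icc (0 : ℝ) 1) :
    HasSum (fun p : ℕ => a p / (((p : ℝ) + 1) * Real.pi) ^ 2 *
      Real.sin (((p : ℝ) + 1) * Real.pi * x)) (∫ ξ in (0 : ℝ)..1, G0 x ξ * w ξ) := by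
  have hmem {ξ : ℝ} (hξ : ξ ∈ Set.uIoc (0 : ℝ) 1) : ξ ∈ Set.Icc (0 : ℝ) 1 := by
    rw [Set.uIoc_of_le zero_le_one] at hξ
    exact Set.Ioc_subset_Icc_self hξ
  have h := intervalIntegral.hasSum_integral_of_dominated_convergence
    (μ := MeasureTheory.volume) (a := 0) (b := 1)
    (F := fun (p : ℕ) ξ => G0 x ξ * (a p * Real.sin (((p : ℝ) + 1) * Real.pi * ξ)))
    (f := fun ξ => G0 x ξ * w ξ) (fun p _ => |a p|)
    (fun p => ((continuous_G0 x).mul (by fun_prop)).aestronglyMeasurable)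
    (fun p => .of_forall fun ξ hξ => by
      rw [Real.norm_eq_abs, abs_mul, abs_mul]
      calc _ ≤ 1 * (|a p| * 1) := by
            gcongr
            · exact abs_G0_le_one hx (hmem hξ)
            · exact Real.abs_sin_le_one _
        _ = |a p| := by ring)
    (.of_forall fun _ _ => ha) intervalIntegrable_const
    (.of_forall fun ξ hξ => (hw ξ (hmem hξ)).mul_left _)
  convert! h using 2 with p
  have hsin : Real.sin (((p : ℝ) + 1) * Real.pi) = 0 := by
    exact_mod_cast Real.sin_nat_mul_pi (p + 1)
  have hc : ((p : ℝ) + 1) * Real.pi ≠ 0 := by positivity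
  simp only [mul_left_comm (G0 x _)]
  rw [intervalIntegral.integral_const_mul, integral_G0_mul_sin hc hsin hx]
  ring

lemma hasSum_sine_cubic {x : ℝ} (hx : x ∈ Set.Icc (0 : ℝ) 1) :
    HasSum (fun p : ℕ => 2 * (-1 : ℝ) ^ (p + 1) / (((p : ℝ) + 1) * Real.pi) ^ 3 *
      Real.sin (((p : ℝ) + 1) * Real.pi * x)) (-(1 / 6) * x * (1 - x ^ 2)) := by
  have hy : (1 + x) / 2 ∈ Set.Icc (0 : ℝ) 1 := ⟨by linarith [hx.1], by linarith [hx.2]⟩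
  have h := (hasSum_one_div_nat_pow_mul_sin one_ne_zero hy).mul_left (2 / Real.pi ^ 3)
  rw [← hasSum_nat_add_iff' 1] at h
  convert! h using 1
  · ext p
    have harg : 2 * Real.pi * ((p + 1 : ℕ) : ℝ) * ((1 + x) / 2) =
        ((p : ℝ) + 1) * Real.pi * x + ((p + 1 : ℕ) : ℝ) * Real.pi := by
      push_cast
      ring
    rw [harg, Real.sin_add_nat_mul_pi]
    push_cast
    field_simp
  · have hB : (Polynomial.map (algebraMap ℚ ℝ) (Polynomial.bernoulli (2 * 1 + 1))).eval
        ((1 + x) / 2) = -(x * (1 - x ^ 2)) / 8 := by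
      simp [Polynomial.bernoulli, Finset.sum_range_succ, bernoulli_eq_bernoulli'_of_ne_one,
        bernoulli_one, Nat.choose]
      ring
    rw [hB]
    simp [Nat.factorial]
    field_simp
    ring

lemma abs_one_sub_inv_sq_le_one (p : ℕ) :
    |1 - 1 / (((p : ℝ) + 1) * Real.pi) ^ 2| ≤ 1 := by
  have hp : (0 : ℝ) ≤ p := p.cast_nonneg
  have h1 : 1 ≤ (((p : ℝ) + 1) * Real.pi) ^ 2 :=
    one_le_pow₀ (by nlinarith [Real.pi_gt_three])
  have h2 : 1 / (((p : ℝ) + 1) * Real.pi) ^ 2 ≤ 1 := (div_le_one (by positivity)).2 h1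
  have h3 : 0 ≤ 1 / (((p : ℝ) + 1) * Real.pi) ^ 2 := by positivity
  exact abs_le.2 ⟨by linarith, by linarith⟩

lemma summable_abs_sine_coeff (m : ℕ) :
    Summable fun p : ℕ => |2 * (-1 : ℝ) ^ (p + 1) / (((p : ℝ) + 1) * Real.pi) ^ 3 *
      (1 - 1 / (((p : ℝ) + 1) * Real.pi) ^ 2) ^ m| := by
  have hs : Summable fun p : ℕ => 2 / Real.pi ^ 3 * (1 / ((p + 1 : ℕ) : ℝ) ^ 3) :=
    ((summable_nat_add_iff 1).2 (Real.summable_one_div_nat_pow.2 (by norm_num))).mul_left _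
  refine hs.of_nonneg_of_le (fun _ => abs_nonneg _) fun p => ?_
  rw [abs_mul, abs_pow]
  calc _ ≤ |2 * (-1 : ℝ) ^ (p + 1) / (((p : ℝ) + 1) * Real.pi) ^ 3| * 1 := by
        gcongr
        exact pow_le_one₀ (abs_nonneg _) (abs_one_sub_inv_sq_le_one p)
    _ = _ := by
        have hp : 0 < ((p : ℝ) + 1) * Real.pi := by positivity
        rw [mul_one, abs_div, abs_mul, abs_pow, abs_neg, abs_one, one_pow, abs_two,
          abs_of_pos (pow_pos hp 3)]
        push_cast
        field_simp

/-- The Fourier sine expansion of the Meixner-type polynomials `v_k`: if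
`v₀(x) = x`, `v₁(x) = -(1/6)x(1-x²)` and `v_k = v_{k-1} - ∫₀¹ G₀(·,ξ)v_{k-1}(ξ)dξ` for
`k ≥ 2`, then for `k ≥ 1` and `x ∈ [0,1]` the series
`Σ_{p=1}^∞ (2(-1)^p/(pπ)³)(1 - 1/(pπ)²)^(k-1) sin(pπx)` converges absolutely
to `v_k(x)`. -/
theorem vk_fourier_sine_expansion (v : ℕ → ℝ → ℝ)
    (hv0 : ∀ x ∈ Set.Icc (0 : ℝ) 1, v 0 x = x)
    (hv1 : ∀ x ∈ Set.Icc (0 : ℝ) 1, v 1 x = -(1 / 6) * x * (1 - x ^ 2))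
    (hrec : ∀ k, 2 ≤ k → ∀ x ∈ Set.Icc (0 : ℝ) 1,
      v k x = v (k - 1) x - ∫ ξ in (0 : ℝ)..1, G0 x ξ * v (k - 1) ξ)
    (k : ℕ) (hk : 1 ≤ k) (x : ℝ) (hx : x ∈ Set.Icc (0 : ℝ) 1) :
    Summable (fun p : ℕ =>
      |2 * (-1 : ℝ) ^ (p + 1) / (((p : ℝ) + 1) * Real.pi) ^ 3 *
        (1 - 1 / (((p : ℝ) + 1) * Real.pi) ^ 2) ^ (k - 1) *
        Real.sin (((p : ℝ) + 1) * Real.pi * x)|) ∧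
    v k x = ∑' p : ℕ,
      2 * (-1 : ℝ) ^ (p + 1) / (((p : ℝ) + 1) * Real.pi) ^ 3 *
        (1 - 1 / (((p : ℝ) + 1) * Real.pi) ^ 2) ^ (k - 1) *
        Real.sin (((p : ℝ) + 1) * Real.pi * x) := by
  have hsum (m : ℕ) : ∀ y ∈ Set.Icc (0 : ℝ) 1,
      HasSum (fun p : ℕ => 2 * (-1 : ℝ) ^ (p + 1) / (((p : ℝ) + 1) * Real.pi) ^ 3 *
        (1 - 1 / (((p : ℝ) + 1) * Real.pi) ^ 2) ^ m *
        Real.sin (((p : ℝ) + 1) * Real.pi * y)) (v (m + 1) y) := by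
    induction m with
    | zero =>
      intro y hy
      rw [hv1 y hy]
      simpa using hasSum_sine_cubic hy
    | succ m ih =>
      intro y hy
      rw [hrec (m + 2) (by omega) y hy]
      convert! (ih y hy).sub (hasSum_integral_G0_mul (summable_abs_sine_coeff m) ih hy) using 2
      ring
  obtain ⟨m, rfl⟩ := Nat.exists_eq_add_of_le' hk
  rw [Nat.add_sub_cancel]
  exact ⟨(hsum m x hx).summable.abs, (hsum m x hx).tsum_eq.symm⟩
end

section
/- Let σ > 0, let 0 < ε₂ < min(1, σ), and let k be a real number with k > σ - ε₂. Then ∫₀^{∞} (ρ²/(1+ρ²))^{k/2} · ρ^{-σ} / (1+ρ) dρ ≤ (π / sin(πε₂)) · ((σ-ε₂)/k)^{(σ-ε₂)/2}. -/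
open MeasureTheory

theorem lintegral_rpow_mul_exp_neg_mul_Ioi {a r : ℝ} (ha : 0 < a) (hr : 0 < r) :
    ∫⁻ t in Set.Ioi (0 : ℝ), ENNReal.ofReal (t ^ (a - 1) * Real.exp (-(r * t))) =
      ENNReal.ofReal ((1 / r) ^ a * Real.Gamma a) := by
  have h := Real.integral_rpow_mul_exp_neg_mul_Ioi ha hr
  have hpos : 0 < (1 / r) ^ a * Real.Gamma a :=
    mul_pos (by positivity) (Real.Gamma_pos_of_pos ha)
  rw [← h, ofReal_integral_eq_lintegral_ofReal]
  · exact Integrable.of_integral_ne_zero (by rw [h]; exact hpos.ne')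
  · filter_upwards [ae_restrict_mem measurableSet_Ioi] with t ht
    exact mul_nonneg (Real.rpow_nonneg (le_of_lt ht) _) (Real.exp_pos _).le

theorem lintegral_rpow_neg_div_one_add_Ioi {s : ℝ} (hs : 0 < s) (hs' : s < 1) :
    ∫⁻ x in Set.Ioi (0 : ℝ), ENNReal.ofReal (x ^ (-s) / (1 + x)) =
      ENNReal.ofReal (Real.pi / Real.sin (Real.pi * s)) := by
  calc
    _ = ∫⁻ x in Set.Ioi (0 : ℝ), ∫⁻ t in Set.Ioi (0 : ℝ),
          ENNReal.ofReal (x ^ (-s) * Real.exp (-((1 + x) * t))) := by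
      refine setLIntegral_congr_fun measurableSet_Ioi fun x hx => ?_
      have hx0 : 0 < x := hx
      have h := lintegral_rpow_mul_exp_neg_mul_Ioi one_pos (by positivity : 0 < 1 + x)
      simp only [sub_self, Real.rpow_zero, one_mul, Real.rpow_one, Real.Gamma_one, mul_one] at h
      simp only [ENNReal.ofReal_mul (Real.rpow_nonneg hx0.le (-s))]
      rw [lintegral_const_mul _ (by fun_prop), h, ← ENNReal.ofReal_mul (by positivity),
        mul_one_div]
    _ = ∫⁻ t in Set.Ioi (0 : ℝ), ∫⁻ x in Set.Ioi (0 : ℝ),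
          ENNReal.ofReal (x ^ (-s) * Real.exp (-((1 + x) * t))) :=
      lintegral_lintegral_swap (by
        refine Measurable.aemeasurable ?_
        simp only [Function.uncurry_def]
        fun_prop)
    _ = ∫⁻ t in Set.Ioi (0 : ℝ), ENNReal.ofReal (Real.Gamma (1 - s)) *
          ENNReal.ofReal (t ^ (s - 1) * Real.exp (-(1 * t))) := by
      refine setLIntegral_congr_fun measurableSet_Ioi fun t ht => ?_
      have ht0 : 0 < t := ht
      have h := lintegral_rpow_mul_exp_neg_mul_Ioi (sub_pos.2 hs') ht0
      have hsplit (x : ℝ) : x ^ (-s) * Real.exp (-((1 + x) * t)) =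
          Real.exp (-t) * (x ^ (1 - s - 1) * Real.exp (-(t * x))) := by
        rw [show -((1 + x) * t) = -t + -(t * x) by ring, Real.exp_add,
          show 1 - s - 1 = -s by ring]
        ring
      simp only [hsplit, ENNReal.ofReal_mul (Real.exp_pos (-t)).le]
      rw [lintegral_const_mul _ (by fun_prop), h, ← ENNReal.ofReal_mul (Real.exp_pos _).le,
        ← ENNReal.ofReal_mul (Real.Gamma_pos_of_pos (sub_pos.2 hs')).le, one_div,
        Real.inv_rpow ht0.le, ← Real.rpow_neg ht0.le, neg_sub, one_mul]
      congr 1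
      ring
    _ = ENNReal.ofReal (Real.pi / Real.sin (Real.pi * s)) := by
      rw [lintegral_const_mul _ (by fun_prop), lintegral_rpow_mul_exp_neg_mul_Ioi hs one_pos,
        ← ENNReal.ofReal_mul (Real.Gamma_pos_of_pos (sub_pos.2 hs')).le,
        ← Real.Gamma_mul_Gamma_one_sub, div_one, Real.one_rpow, one_mul, mul_comm]

theorem pi_div_sin_pi_mul_nonneg {s : ℝ} (hs : 0 < s) (hs' : s < 1) :
    0 ≤ Real.pi / Real.sin (Real.pi * s) := by
  rw [← Real.Gamma_mul_Gamma_one_sub]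
  exact (mul_pos (Real.Gamma_pos_of_pos hs) (Real.Gamma_pos_of_pos (sub_pos.2 hs'))).le

theorem integrableOn_rpow_neg_div_one_add_Ioi {s : ℝ} (hs : 0 < s) (hs' : s < 1) :
    IntegrableOn (fun x : ℝ => x ^ (-s) / (1 + x)) (Set.Ioi 0) := by
  refine (lintegral_ofReal_ne_top_iff_integrable ?_ ?_).1 ?_
  · exact Measurable.aestronglyMeasurable (by fun_prop)
  · filter_upwards [ae_restrict_mem measurableSet_Ioi] with x hx
    have hx0 : 0 < x := hx
    change 0 ≤ x ^ (-s) / (1 + x)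
    positivity
  · rw [lintegral_rpow_neg_div_one_add_Ioi hs hs']
    exact ENNReal.ofReal_ne_top

theorem integral_rpow_neg_div_one_add_Ioi {s : ℝ} (hs : 0 < s) (hs' : s < 1) :
    ∫ x in Set.Ioi (0 : ℝ), x ^ (-s) / (1 + x) = Real.pi / Real.sin (Real.pi * s) := by
  rw [integral_eq_lintegral_of_nonneg_ae, lintegral_rpow_neg_div_one_add_Ioi hs hs',
    ENNReal.toReal_ofReal (pi_div_sin_pi_mul_nonneg hs hs')]
  · filter_upwards [ae_restrict_mem measurableSet_Ioi] with x hx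
    have hx0 : 0 < x := hx
    change 0 ≤ x ^ (-s) / (1 + x)
    positivity
  · exact Measurable.aestronglyMeasurable (by fun_prop)

theorem rpow_mul_one_sub_rpow_le {q t : ℝ} (hq : 0 < q) (hq' : q ≤ 1) (ht : 0 ≤ t)
    (ht' : t ≤ 1) : t ^ (1 - q) * (1 - t) ^ q ≤ q ^ q := by
  have h1t : 0 ≤ 1 - t := sub_nonneg.2 ht'
  have h := Real.geom_mean_le_arith_mean2_weighted (sub_nonneg.2 hq') hq.le ht
    (div_nonneg h1t hq.le) (by ring)
  rw [mul_div_cancel₀ _ hq.ne', Real.div_rpow h1t hq.le, ← mul_div_assoc,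
    div_le_iff₀ (Real.rpow_pos_of_pos hq q)] at h
  refine h.trans (mul_le_of_le_one_left (Real.rpow_nonneg hq.le q) ?_)
  nlinarith

theorem sq_div_one_add_sq_rpow_mul_rpow_neg_le {a k x : ℝ} (ha : 0 < a) (hk : a ≤ k)
    (hx : 0 < x) :
    (x ^ 2 / (1 + x ^ 2)) ^ (k / 2) * x ^ (-a) ≤ (a / k) ^ (a / 2) := by
  have hk0 : 0 < k := ha.trans_le hk
  set t := x ^ 2 / (1 + x ^ 2) with ht
  have ht0 : 0 < t := by positivity
  have hsub : 1 - t = t * (x ^ 2)⁻¹ := by rw [ht]; field_simp; ring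
  have hsub0 : 0 < 1 - t := by rw [hsub]; positivity
  have h := Real.rpow_le_rpow (by positivity) (rpow_mul_one_sub_rpow_le
    (div_pos ha hk0) ((div_le_one hk0).2 hk) ht0.le (sub_pos.1 hsub0).le)
    (half_pos hk0).le
  have hexp : a / k * (k / 2) = a / 2 := by field_simp
  have hexp' : (1 - a / k) * (k / 2) + a / 2 = k / 2 := by rw [sub_mul, hexp]; ring
  rw [← Real.rpow_mul (by positivity), hexp, Real.mul_rpow (by positivity) (by positivity),
    ← Real.rpow_mul ht0.le, ← Real.rpow_mul hsub0.le, hexp, hsub,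
    Real.mul_rpow ht0.le (by positivity), ← mul_assoc, ← Real.rpow_add ht0, hexp',
    Real.inv_rpow (by positivity), ← Real.rpow_natCast, ← Real.rpow_mul hx.le,
    ← Real.rpow_neg hx.le] at h
  convert h using 3
  push_cast
  ring

open MeasureTheory

/-- Scalar integral estimate of Lemma 5 of the paper: for `σ > 0`,
`0 < ε₂ < min(1,σ)` and real `k > σ - ε₂`,
`∫₀^∞ (ρ²/(1+ρ²))^(k/2) ρ^(-σ)/(1+ρ) dρ ≤ (π/sin(πε₂)) ((σ-ε₂)/k)^((σ-ε₂)/2)`. -/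
theorem integral_cayley_kernel_estimate (σ ε₂ k : ℝ) (hσ : 0 < σ)
    (hε₂ : 0 < ε₂) (hε₂' : ε₂ < min 1 σ) (hk : σ - ε₂ < k) :
    (∫ ρ in Set.Ioi (0 : ℝ), (ρ ^ 2 / (1 + ρ ^ 2)) ^ (k / 2) * ρ ^ (-σ) / (1 + ρ)) ≤
      Real.pi / Real.sin (Real.pi * ε₂) * ((σ - ε₂) / k) ^ ((σ - ε₂) / 2) := by
  obtain ⟨hε₁, hεσ⟩ := lt_min_iff.1 hε₂'
  have hint := integrableOn_rpow_neg_div_one_add_Ioi hε₂ hε₁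
  rw [← integral_rpow_neg_div_one_add_Ioi hε₂ hε₁, ← integral_mul_const]
  refine integral_mono_of_nonneg ?_ (hint.mul_const _) ?_
  · filter_upwards [ae_restrict_mem measurableSet_Ioi] with x hx
    have hx0 : 0 < x := hx
    change 0 ≤ (x ^ 2 / (1 + x ^ 2)) ^ (k / 2) * x ^ (-σ) / (1 + x)
    positivity
  · filter_upwards [ae_restrict_mem measurableSet_Ioi] with x hx
    have hx0 : 0 < x := hx
    have hsplit : x ^ (-σ) = x ^ (-(σ - ε₂)) * x ^ (-ε₂) := by
      rw [← Real.rpow_add hx0]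
      congr 1
      ring
    calc (x ^ 2 / (1 + x ^ 2)) ^ (k / 2) * x ^ (-σ) / (1 + x)
        = x ^ (-ε₂) / (1 + x) * ((x ^ 2 / (1 + x ^ 2)) ^ (k / 2) * x ^ (-(σ - ε₂))) := by
          rw [hsplit]
          ring
      _ ≤ x ^ (-ε₂) / (1 + x) * ((σ - ε₂) / k) ^ ((σ - ε₂) / 2) :=
          mul_le_mul_of_nonneg_left
            (sq_div_one_add_sq_rpow_mul_rpow_neg_le (sub_pos.2 hεσ) hk.le hx0) (by positivity)
end

section
/- Let 𝒜 be a unital C*-algebra, let a ∈ 𝒜 be a positive invertible element, let σ be a real number and k a natural number with k > σ > 0. Then ‖((1+a)⁻¹ · a)^k · a^{-σ}‖ ≤ σ^σ / k^σ, where a^{-σ} denotes the real power of the positive invertible element a given by the continuous functional calculus. -/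
open scoped NNReal

/-- The maximum of `x ↦ (x / (1 + x)) ^ k * x ^ (-σ)` on the positive half-line is at most
`σ ^ σ / k ^ σ`. -/
lemma cayley_pow_mul_rpow_neg_le {x σ : ℝ} {k : ℕ} (hx : 0 < x) (hσ : 0 < σ) (hk : σ < k) :
    ((1 + x)⁻¹ * x) ^ k * x ^ (-σ) ≤ σ ^ σ / (k : ℝ) ^ σ := by
  have hk0 : (0 : ℝ) < k := hσ.trans hk
  have hx1 : 0 < 1 + x := by positivity
  have amgm : (k / (σ * (1 + x))) ^ (σ / k) * (x / (1 + x)) ^ (1 - σ / k) ≤ 1 := by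
    refine (Real.geom_mean_le_arith_mean2_weighted (by positivity)
      (sub_nonneg.2 ((div_le_one hk0).2 hk.le)) (by positivity) (by positivity)
      (by ring)).trans ?_
    have h : σ / k * (k / (σ * (1 + x))) + (1 - σ / k) * (x / (1 + x))
        = 1 - σ / k * (x / (1 + x)) := by
      field_simp
      ring
    rw [h]
    have : 0 ≤ σ / k * (x / (1 + x)) := by positivity
    linarith
  have h := pow_le_one₀ (n := k) (by positivity) amgm
  rw [mul_pow, ← Real.rpow_mul_natCast (by positivity), ← Real.rpow_mul_natCast (by positivity),
    div_mul_cancel₀ _ hk0.ne', sub_mul, one_mul, div_mul_cancel₀ _ hk0.ne',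
    Real.rpow_sub (by positivity), Real.rpow_natCast, Real.div_rpow hk0.le (by positivity),
    Real.mul_rpow hσ.le hx1.le, Real.div_rpow hx.le hx1.le] at h
  rw [Real.rpow_neg hx.le, le_div_iff₀ (by positivity), inv_mul_eq_div]
  have hσσ : 0 < σ ^ σ := by positivity
  calc _ = σ ^ σ * (k ^ σ / (σ ^ σ * (1 + x) ^ σ) * ((x / (1 + x)) ^ k /
        (x ^ σ / (1 + x) ^ σ))) := by field_simp
    _ ≤ σ ^ σ := mul_le_of_le_one_right hσσ.le h

/-- Operator form of Lemma 5's kernel estimate: in a unital C*-algebra, if `a` is a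
positive invertible element and `k > σ > 0` (`k : ℕ`, `σ : ℝ`), then
`‖((1+a)⁻¹ a)^k a^(-σ)‖ ≤ σ^σ / k^σ`, where `a^(-σ)` is the real power given by the
continuous functional calculus. -/
theorem norm_cayley_pow_rpow_le {A : Type*} [CStarAlgebra A]
    [PartialOrder A] [StarOrderedRing A]
    (a : A) (ha : 0 ≤ a) (ha' : IsUnit a) (σ : ℝ) (k : ℕ)
    (hσ : 0 < σ) (hk : σ < k) :
    ‖(Ring.inverse (1 + a) * a) ^ k * CFC.rpow a (-σ)‖ ≤ σ ^ σ / (k : ℝ) ^ σ := by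
  have hsa : IsSelfAdjoint a := .of_nonneg ha
  have hpos : ∀ x ∈ spectrum ℝ a, 0 < x := fun x hx ↦
    (spectrum_nonneg_of_nonneg ha hx).lt_of_ne' fun h ↦
      spectrum.zero_notMem ℝ ha' (h ▸ hx)
  have hne : ∀ x ∈ spectrum ℝ a, 1 + x ≠ 0 := fun x hx ↦ by linarith [hpos x hx]
  have hinv : ContinuousOn (fun x : ℝ ↦ (1 + x)⁻¹) (spectrum ℝ a) := by
    fun_prop (disch := assumption)
  have hrpow : ContinuousOn (fun x : ℝ ↦ x ^ (-σ)) (spectrum ℝ a) :=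
    continuousOn_id.rpow_const fun x hx ↦ .inl (hpos x hx).ne'
  have hcayley : Ring.inverse (1 + a) * a = cfc (fun x : ℝ ↦ (1 + x)⁻¹ * x) a := by
    rw [cfc_mul (fun x : ℝ ↦ (1 + x)⁻¹) (fun x ↦ x) a hinv,
      cfc_inv (fun x : ℝ ↦ 1 + x) a hne, cfc_const_add 1 (fun x : ℝ ↦ x) a, cfc_id' ℝ a, map_one]
  have hcfc : (Ring.inverse (1 + a) * a) ^ k * CFC.rpow a (-σ)
      = cfc (fun x : ℝ ↦ ((1 + x)⁻¹ * x) ^ k * x ^ (-σ)) a := by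
    rw [cfc_mul (fun x : ℝ ↦ ((1 + x)⁻¹ * x) ^ k) (fun x ↦ x ^ (-σ)) a
        ((hinv.mul continuousOn_id).pow k) hrpow,
      cfc_pow (fun x : ℝ ↦ (1 + x)⁻¹ * x) k a (hinv.mul continuousOn_id), ← hcayley,
      CFC.rpow_eq_pow, CFC.rpow_eq_cfc_real]
  rw [hcfc]
  refine norm_cfc_le (by positivity) fun x hx ↦ ?_
  have hx0 := hpos x hx
  rw [Real.norm_of_nonneg (by positivity)]
  exact cayley_pow_mul_rpow_neg_le hx0 hσ hk
end

section
/- Let 𝒜 be a unital C*-algebra, let a ∈ 𝒜 be a positive element, and let k ≥ 1 be a natural number. Then ‖( a · (1+a)⁻¹ · (1 + a/k)⁻¹ )^k‖ ≤ e · e^{-2√k}. -/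
/-- The bound `x - x ^ 2 / 2 ≤ log (1 + x)` for `x ≥ 0`, in exponential form. -/
theorem exp_sub_sq_half_le_one_add {x : ℝ} (hx : 0 ≤ x) :
    Real.exp (x - x ^ 2 / 2) ≤ 1 + x := by
  rw [← Real.le_log_iff_exp_le (by positivity)]
  refine le_trans ?_ (Real.le_log_one_add_of_nonneg hx)
  rw [le_div_iff₀ (by positivity)]
  nlinarith [pow_nonneg hx 3]

/-- The AM-GM bound `t (1 + x) ^ 2 ≤ (1 + t) (1 + x ^ 2 t)`, in exponential form. -/
theorem mul_inv_mul_inv_le_exp {t x : ℝ} (ht : 0 ≤ t) (hx : 0 ≤ x) :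
    t * (1 + t)⁻¹ * (1 + x ^ 2 * t)⁻¹ ≤ Real.exp (x ^ 2 - 2 * x) := by
  have hexp : Real.exp (x ^ 2 - 2 * x) = (Real.exp (x - x ^ 2 / 2) ^ 2)⁻¹ := by
    rw [← Real.exp_nat_mul, ← Real.exp_neg]
    congr 1
    push_cast
    ring
  rw [hexp, mul_assoc, ← mul_inv, ← div_eq_mul_inv, div_le_iff₀ (by positivity),
    ← div_eq_inv_mul, le_div_iff₀ (by positivity)]
  calc t * Real.exp (x - x ^ 2 / 2) ^ 2 ≤ t * (1 + x) ^ 2 := by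
        gcongr
        exact exp_sub_sq_half_le_one_add hx
    _ ≤ (1 + t) * (1 + x ^ 2 * t) := by nlinarith [sq_nonneg (1 - x * t)]

theorem pow_mul_inv_mul_inv_le_exp {t : ℝ} (ht : 0 ≤ t) {k : ℕ} (hk : 1 ≤ k) :
    (t * (1 + t)⁻¹ * (1 + (k : ℝ)⁻¹ * t)⁻¹) ^ k ≤
      Real.exp 1 * Real.exp (-2 * Real.sqrt k) := by
  have hk' : (0 : ℝ) < k := by exact_mod_cast hk
  have hs : 0 < Real.sqrt k := Real.sqrt_pos.2 hk'
  have hsq : Real.sqrt k ^ 2 = k := Real.sq_sqrt hk'.le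
  have h := mul_inv_mul_inv_le_exp ht (inv_nonneg.2 hs.le)
  rw [inv_pow, hsq] at h
  refine (pow_le_pow_left₀ (by positivity) h k).trans_eq ?_
  rw [← Real.exp_nat_mul, ← Real.exp_add]
  congr 1
  have hinv : (k : ℝ) * (k : ℝ)⁻¹ = 1 := mul_inv_cancel₀ hk'.ne'
  have hdiv : (k : ℝ) * (Real.sqrt k)⁻¹ = Real.sqrt k := by
    rw [← div_eq_mul_inv, Real.div_sqrt]
  linear_combination hinv - 2 * hdiv

/-- Operator form of Lemma 3's estimate: in a unital C*-algebra, if `a` is a positive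
element and `k ≥ 1`, then `‖(a (1+a)⁻¹ (1+a/k)⁻¹)^k‖ ≤ e·e^(-2√k)`. -/
theorem norm_cayley_pow_le_exp {A : Type*} [CStarAlgebra A]
    [PartialOrder A] [StarOrderedRing A]
    (a : A) (ha : 0 ≤ a) (k : ℕ) (hk : 1 ≤ k) :
    ‖(a * Ring.inverse (1 + a) * Ring.inverse (1 + (k : ℂ)⁻¹ • a)) ^ k‖ ≤
      Real.exp 1 * Real.exp (-2 * Real.sqrt k) := by
  have hsa : IsSelfAdjoint a := ha.isSelfAdjoint
  have hspec : ∀ t ∈ spectrum ℝ a, 0 ≤ t := fun t ht ↦ spectrum_nonneg_of_nonneg ha ht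
  have affine (c : ℝ) : cfc (fun t : ℝ ↦ 1 + c * t) a = 1 + c • a := by
    rw [cfc_const_add (1 : ℝ) (fun t ↦ c * t) a, cfc_const_mul_id c a, map_one]
  have hne {c : ℝ} (hc : 0 ≤ c) : ∀ t ∈ spectrum ℝ a, 1 + c * t ≠ 0 := fun t ht ↦ by
    have := hspec t ht
    positivity
  have resolvent {c : ℝ} (hc : 0 ≤ c) :
      cfc (fun t : ℝ ↦ (1 + c * t)⁻¹) a = Ring.inverse (1 + c • a) := by
    rw [cfc_inv (fun t : ℝ ↦ 1 + c * t) a (hne hc), affine]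
  have hcont {c : ℝ} (hc : 0 ≤ c) :
      ContinuousOn (fun t : ℝ ↦ (1 + c * t)⁻¹) (spectrum ℝ a) :=
    ContinuousOn.inv₀ (by fun_prop) (hne hc)
  have hk0 : (0 : ℝ) ≤ (k : ℝ)⁻¹ := by positivity
  have hsmul : (k : ℂ)⁻¹ • a = (k : ℝ)⁻¹ • a := by
    rw [← Complex.coe_smul]
    push_cast
    rfl
  have hcfc : (a * Ring.inverse (1 + a) * Ring.inverse (1 + (k : ℂ)⁻¹ • a)) ^ k =
      cfc (fun t : ℝ ↦ (t * (1 + 1 * t)⁻¹ * (1 + (k : ℝ)⁻¹ * t)⁻¹) ^ k) a := by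
    have h1 := hcont zero_le_one
    have h2 := hcont hk0
    have h12 : ContinuousOn (fun t : ℝ ↦ t * (1 + 1 * t)⁻¹) (spectrum ℝ a) :=
      continuousOn_id.mul h1
    rw [cfc_pow _ k a (h12.fun_mul h2), cfc_mul _ _ a h12 h2,
      cfc_mul (fun t : ℝ ↦ t) _ a continuousOn_id h1, cfc_id' ℝ a,
      resolvent zero_le_one, resolvent hk0, one_smul, hsmul]
  rw [hcfc]
  refine norm_cfc_le (by positivity) fun t ht ↦ ?_
  have ht0 := hspec t ht
  rw [Real.norm_of_nonneg (by positivity), one_mul]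
  exact pow_mul_inv_mul_inv_le_exp ht0 hk
end

section
/- Let σ > -2, let N ≥ 1 be a natural number, and let (a_k)_{k≥1} be a sequence of nonnegative real numbers such that Σ_{k=1}^{∞} k^{σ+1} a_k² < ∞. Then Σ_{k=N+1}^{∞} a_k / k ≤ (1/√(2+σ)) · N^{-(2+σ)/2} · ( Σ_{k=1}^{∞} k^{σ+1} a_k² )^{1/2}. -/
theorem sum_range_rpow_neg_le {p x : ℝ} (hp : 0 < p) (hx : 0 < x) (n : ℕ) :
    ∑ k ∈ Finset.range n, (x + ((k + 1 : ℕ) : ℝ)) ^ (-(p + 1)) ≤ x ^ (-p) / p := by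
  have hpos : ∀ y ∈ Set.Icc x (x + n), 0 < y := fun y hy => hx.trans_le hy.1
  have hanti : AntitoneOn (fun y : ℝ => y ^ (-(p + 1))) (Set.Icc x (x + n)) :=
    (Real.antitoneOn_rpow_Ioi_of_exponent_nonpos (by linarith)).mono hpos
  have hle : x ≤ x + n := le_add_of_nonneg_right n.cast_nonneg
  have hzero : (0 : ℝ) ∉ Set.uIcc x (x + n) := by
    rw [Set.uIcc_of_le hle]
    exact fun h => (hpos 0 h).ne' rfl
  refine hanti.sum_le_integral.trans ?_
  rw [integral_rpow (Or.inr ⟨by linarith, hzero⟩), show -(p + 1) + 1 = -p by ring,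
    div_neg, ← neg_div, neg_sub]
  gcongr
  exact sub_le_self _ (Real.rpow_nonneg (hx.le.trans hle) _)


/-- Tail estimate via the Cauchy–Schwarz inequality: if `σ > -2`, `N ≥ 1` and
`(a_k)_{k ≥ 1}` are nonnegative reals with `Σ k^(σ+1) a_k² < ∞`, then
`Σ_{k=N+1}^∞ a_k/k ≤ (2+σ)^(-1/2) N^(-(2+σ)/2) (Σ_{k=1}^∞ k^(σ+1) a_k²)^(1/2)`. -/
theorem tail_sum_div_cauchy_schwarz (σ : ℝ) (hσ : -2 < σ) (N : ℕ) (hN : 1 ≤ N)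
    (a : ℕ → ℝ) (ha : ∀ k, 0 ≤ a k)
    (hsum : Summable (fun k : ℕ => ((k : ℝ) + 1) ^ (σ + 1) * (a (k + 1)) ^ 2)) :
    (∑' k : ℕ, a (k + N + 1) / ((k : ℝ) + N + 1)) ≤
      (1 / Real.sqrt (2 + σ)) * (N : ℝ) ^ (-((2 + σ) / 2)) *
        Real.sqrt (∑' k : ℕ, ((k : ℝ) + 1) ^ (σ + 1) * (a (k + 1)) ^ 2) := by
  have hp : 0 < 2 + σ := by linarith
  have hN' : (0 : ℝ) < N := by exact_mod_cast hN
  refine Real.tsum_le_of_sum_range_le (fun k => div_nonneg (ha _) (by positivity)) fun n => ?_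
  set S := ∑' k : ℕ, ((k : ℝ) + 1) ^ (σ + 1) * (a (k + 1)) ^ 2
  have hterm : ∀ k : ℕ, a (k + N + 1) / ((k : ℝ) + N + 1) =
      √(((N : ℝ) + ((k + 1 : ℕ) : ℝ)) ^ (-((2 + σ) + 1))) *
        √((((k + N : ℕ) : ℝ) + 1) ^ (σ + 1) * (a (k + N + 1)) ^ 2) := by
    intro k
    have hx : (0 : ℝ) < (k : ℝ) + N + 1 := by positivity
    rw [show (N : ℝ) + ((k + 1 : ℕ) : ℝ) = (k : ℝ) + N + 1 by push_cast; ring,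
      Nat.cast_add, ← Real.sqrt_mul (by positivity), ← mul_assoc, ← Real.rpow_add hx,
      show -((2 + σ) + 1) + (σ + 1) = -(2 : ℕ) by push_cast; ring, Real.rpow_neg hx.le,
      Real.rpow_natCast, inv_mul_eq_div, ← div_pow,
      Real.sqrt_sq (div_nonneg (ha _) hx.le)]
  have htail : ∑ k ∈ Finset.range n, (((k + N : ℕ) : ℝ) + 1) ^ (σ + 1) * (a (k + N + 1)) ^ 2
      ≤ S := by
    have hnn : ∀ k : ℕ, 0 ≤ ((k : ℝ) + 1) ^ (σ + 1) * (a (k + 1)) ^ 2 :=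
      fun k => by positivity
    have h := hsum.sum_le_tsum ((Finset.range n).map (addRightEmbedding N)) fun k _ => hnn k
    simpa only [Finset.sum_map, addRightEmbedding_apply] using h
  have hsqrt : √((N : ℝ) ^ (-(2 + σ)) / (2 + σ)) =
      1 / √(2 + σ) * (N : ℝ) ^ (-((2 + σ) / 2)) := by
    rw [Real.sqrt_div (by positivity), Real.sqrt_eq_rpow ((N : ℝ) ^ _),
      ← Real.rpow_mul hN'.le, show -(2 + σ) * (1 / 2) = -((2 + σ) / 2) by ring]
    ring
  rw [Finset.sum_congr rfl fun k _ => hterm k, ← hsqrt]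
  refine (Real.sum_sqrt_mul_sqrt_le _ (fun k => by positivity) fun k => by positivity).trans ?_
  gcongr
  exact sum_range_rpow_neg_le hp hN' n
end

section
/- For every real λ > 0 and every x ∈ [0,1], one has sinh(x√λ)/sinh(√λ) = Σ_{k=0}^{∞} v_k(x) · (λ/(1+λ))^k, the series converging absolutely. -/
/-- Closed form, on the whole line, of the integral operator with kernel `G0`. -/
noncomputable def greenOp (f : ℝ → ℝ) (x : ℝ) : ℝ :=
  x * ((∫ t in (0 : ℝ)..1, f t) - (∫ t in (0 : ℝ)..1, t * f t) - ∫ t in (0 : ℝ)..x, f t)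
    + ∫ t in (0 : ℝ)..x, t * f t

theorem integral_G0_mul {f : ℝ → ℝ} (hf : Continuous f) {x : ℝ} (hx : x ∈ Set.Icc (0 : ℝ) 1) :
    ∫ t in (0 : ℝ)..1, G0 x t * f t = greenOp f x := by
  have hf' : Continuous fun t : ℝ => t * f t := continuous_id.mul hf
  have int_f : ∀ a b : ℝ, IntervalIntegrable f MeasureTheory.volume a b :=
    fun a b => hf.intervalIntegrable a b
  have int_f' : ∀ a b : ℝ, IntervalIntegrable (fun t => t * f t) MeasureTheory.volume a b :=
    fun a b => hf'.intervalIntegrable a b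
  have eq_left : Set.EqOn (fun t => (1 - x) * (t * f t)) (fun t => G0 x t * f t)
      (Set.uIcc 0 x) := by
    intro t ht
    rw [Set.uIcc_of_le hx.1] at ht
    simp only [G0]
    split_ifs with h
    · rw [le_antisymm ht.2 h]; ring
    · ring
  have eq_right : Set.EqOn (fun t => x * (f t - t * f t)) (fun t => G0 x t * f t)
      (Set.uIcc x 1) := by
    intro t ht
    rw [Set.uIcc_of_le hx.2] at ht
    simp only [G0, if_pos ht.1]
    ring
  have int_left : IntervalIntegrable (fun t => G0 x t * f t) MeasureTheory.volume 0 x :=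
    ((int_f' 0 x).const_mul (1 - x)).congr (eq_left.mono Set.uIoc_subset_uIcc)
  have int_right : IntervalIntegrable (fun t => G0 x t * f t) MeasureTheory.volume x 1 :=
    (((int_f x 1).sub (int_f' x 1)).const_mul x).congr (eq_right.mono Set.uIoc_subset_uIcc)
  rw [← intervalIntegral.integral_add_adjacent_intervals int_left int_right,
    ← intervalIntegral.integral_congr eq_left, ← intervalIntegral.integral_congr eq_right,
    intervalIntegral.integral_const_mul, intervalIntegral.integral_const_mul,
    intervalIntegral.integral_sub (int_f x 1) (int_f' x 1), greenOp,
    ← intervalIntegral.integral_add_adjacent_intervals (int_f 0 x) (int_f x 1),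
    ← intervalIntegral.integral_add_adjacent_intervals (int_f' 0 x) (int_f' x 1)]
  ring

theorem hasDerivAt_integral_zero {f : ℝ → ℝ} (hf : Continuous f) (x : ℝ) :
    HasDerivAt (fun y => ∫ t in (0 : ℝ)..y, f t) (f x) x :=
  intervalIntegral.integral_hasDerivAt_right (hf.intervalIntegrable 0 x)
    hf.aestronglyMeasurable.stronglyMeasurableAtFilter hf.continuousAt

theorem hasDerivAt_greenOp {f : ℝ → ℝ} (hf : Continuous f) (x : ℝ) :
    HasDerivAt (greenOp f)
      ((∫ t in (0 : ℝ)..1, f t) - (∫ t in (0 : ℝ)..1, t * f t) - ∫ t in (0 : ℝ)..x, f t) x := by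
  have hF := hasDerivAt_integral_zero hf x
  have hH := hasDerivAt_integral_zero (continuous_id.mul hf) x
  have h := ((hasDerivAt_id x).mul (hF.const_sub
    ((∫ t in (0 : ℝ)..1, f t) - (∫ t in (0 : ℝ)..1, t * f t)))).add hH
  refine h.congr_deriv ?_
  simp

theorem continuous_greenOp {f : ℝ → ℝ} (hf : Continuous f) : Continuous (greenOp f) :=
  continuous_iff_continuousAt.2 fun x => (hasDerivAt_greenOp hf x).continuousAt

theorem greenOp_zero (f : ℝ → ℝ) : greenOp f 0 = 0 := by simp [greenOp]

theorem greenOp_one (f : ℝ → ℝ) : greenOp f 1 = 0 := by simp [greenOp]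

theorem greenOp_linear {f g : ℝ → ℝ} (hf : Continuous f) (hg : Continuous g) (a b x : ℝ) :
    greenOp (fun t => a * f t + b * g t) x = a * greenOp f x + b * greenOp g x := by
  have h₁ : ∀ y : ℝ, ∫ t in (0 : ℝ)..y, (a * f t + b * g t)
      = a * (∫ t in (0 : ℝ)..y, f t) + b * ∫ t in (0 : ℝ)..y, g t := fun y => by
    rw [intervalIntegral.integral_add ((hf.intervalIntegrable 0 y).const_mul a)
      ((hg.intervalIntegrable 0 y).const_mul b), intervalIntegral.integral_const_mul,
      intervalIntegral.integral_const_mul]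
  have h₂ : ∀ y : ℝ, ∫ t in (0 : ℝ)..y, t * (a * f t + b * g t)
      = a * (∫ t in (0 : ℝ)..y, t * f t) + b * ∫ t in (0 : ℝ)..y, t * g t := fun y => by
    rw [← intervalIntegral.integral_const_mul, ← intervalIntegral.integral_const_mul,
      ← intervalIntegral.integral_add (Continuous.intervalIntegrable (by fun_prop) 0 y)
        (Continuous.intervalIntegrable (by fun_prop) 0 y)]
    congr 1
    ext t
    ring
  simp only [greenOp, h₁, h₂]
  ring

/-- `I - greenOp` is a contraction of `L²(0,1)`. -/
theorem integral_sq_sub_greenOp_le {f : ℝ → ℝ} (hf : Continuous f) :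
    ∫ t in (0 : ℝ)..1, (f t - greenOp f t) ^ 2 ≤ ∫ t in (0 : ℝ)..1, f t ^ 2 := by
  set w := greenOp f with hw
  set p : ℝ → ℝ := fun x =>
    (∫ t in (0 : ℝ)..1, f t) - (∫ t in (0 : ℝ)..1, t * f t) - ∫ t in (0 : ℝ)..x, f t with hp
  have w_deriv : ∀ x, HasDerivAt w (p x) x := hasDerivAt_greenOp hf
  have p_deriv : ∀ x, HasDerivAt p (-f x) x := fun x =>
    (hasDerivAt_integral_zero hf x).const_sub _
  have w_cont : Continuous w := continuous_greenOp hf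
  have p_cont : Continuous p := continuous_iff_continuousAt.2 fun x => (p_deriv x).continuousAt
  -- The boundary term `p w - φ w²` with `φ x = 1 / 2 - x` vanishes at both ends.
  have boundary_deriv : ∀ x, HasDerivAt (fun x => p x * w x - (1 / 2 - x) * w x ^ 2)
      (-f x * w x + p x ^ 2 + w x ^ 2 - (1 / 2 - x) * (2 * w x * p x)) x := fun x => by
    have h := ((p_deriv x).mul (w_deriv x)).sub
      (((hasDerivAt_id x).const_sub (1 / 2)).mul ((w_deriv x).pow 2))
    refine h.congr_deriv ?_
    simp
    ring
  have boundary : ∫ x in (0 : ℝ)..1,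
      (-f x * w x + p x ^ 2 + w x ^ 2 - (1 / 2 - x) * (2 * w x * p x)) = 0 := by
    rw [intervalIntegral.integral_eq_sub_of_hasDerivAt (fun x _ => boundary_deriv x)
      (Continuous.intervalIntegrable (by fun_prop) 0 1)]
    simp [hw, greenOp_zero, greenOp_one]
  have mono : ∫ x in (0 : ℝ)..1, ((f x - w x) ^ 2 - 2 *
      (-f x * w x + p x ^ 2 + w x ^ 2 - (1 / 2 - x) * (2 * w x * p x)))
      ≤ ∫ x in (0 : ℝ)..1, f x ^ 2 := by
    refine intervalIntegral.integral_mono_on zero_le_one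
      (Continuous.intervalIntegrable (by fun_prop) 0 1)
      (Continuous.intervalIntegrable (by fun_prop) 0 1) fun x hx => ?_
    have h : 0 ≤ w x ^ 2 * (1 / 4 - (1 / 2 - x) ^ 2) :=
      mul_nonneg (sq_nonneg _) (by nlinarith [hx.1, hx.2])
    nlinarith [sq_nonneg (p x - (1 / 2 - x) * w x), sq_nonneg (w x)]
  rwa [intervalIntegral.integral_sub (Continuous.intervalIntegrable (by fun_prop) 0 1)
    (Continuous.intervalIntegrable (by fun_prop) 0 1), intervalIntegral.integral_const_mul,
    boundary, mul_zero, sub_zero] at mono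

theorem abs_greenOp_le {f : ℝ → ℝ} (hf : Continuous f) {x : ℝ} (hx : x ∈ Set.Icc (0 : ℝ) 1) :
    |greenOp f x| ≤ 1 + ∫ t in (0 : ℝ)..1, f t ^ 2 := by
  rw [← integral_G0_mul hf hx]
  have hbound : IntervalIntegrable (fun t => 1 + f t ^ 2) MeasureTheory.volume 0 1 :=
    Continuous.intervalIntegrable (by fun_prop) 0 1
  have h : ‖∫ t in (0 : ℝ)..1, G0 x t * f t‖ ≤ ∫ t in (0 : ℝ)..1, (1 + f t ^ 2) := by
    refine intervalIntegral.norm_integral_le_of_norm_le zero_le_one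
      (Filter.Eventually.of_forall fun t ht => ?_) hbound
    have hG : |G0 x t| ≤ 1 := by
      rw [abs_le, G0]
      split_ifs <;> constructor <;> nlinarith [hx.1, hx.2, ht.1, ht.2]
    rw [Real.norm_eq_abs, abs_mul]
    nlinarith [abs_nonneg (f t), sq_abs (f t), sq_nonneg (|f t| - 1)]
  rw [intervalIntegral.integral_add (Continuous.intervalIntegrable (by fun_prop) 0 1)
    (Continuous.intervalIntegrable (by fun_prop) 0 1)] at h
  simpa using h

/-- The iterates of `I - greenOp`. -/
noncomputable def iterSubGreenOp (f : ℝ → ℝ) : ℕ → ℝ → ℝ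
  | 0 => f
  | n + 1 => fun x => iterSubGreenOp f n x - greenOp (iterSubGreenOp f n) x

theorem continuous_iterSubGreenOp {f : ℝ → ℝ} (hf : Continuous f) (n : ℕ) :
    Continuous (iterSubGreenOp f n) := by
  induction n with
  | zero => exact hf
  | succ n ih => exact ih.sub (continuous_greenOp ih)

theorem integral_sq_iterSubGreenOp_le {f : ℝ → ℝ} (hf : Continuous f) (n : ℕ) :
    ∫ t in (0 : ℝ)..1, iterSubGreenOp f n t ^ 2 ≤ ∫ t in (0 : ℝ)..1, f t ^ 2 := by
  induction n with
  | zero => exact le_rfl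
  | succ n ih => exact (integral_sq_sub_greenOp_le (continuous_iterSubGreenOp hf n)).trans ih

theorem abs_iterSubGreenOp_le {f : ℝ → ℝ} (hf : Continuous f) {x : ℝ}
    (hx : x ∈ Set.Icc (0 : ℝ) 1) (n : ℕ) :
    |iterSubGreenOp f n x| ≤ |f x| + n * (1 + ∫ t in (0 : ℝ)..1, f t ^ 2) := by
  induction n with
  | zero => simp [iterSubGreenOp]
  | succ n ih =>
    have h₁ := abs_greenOp_le (continuous_iterSubGreenOp hf n) hx
    have h₂ := integral_sq_iterSubGreenOp_le hf n
    have h₃ := abs_sub (iterSubGreenOp f n x) (greenOp (iterSubGreenOp f n) x)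
    simp only [iterSubGreenOp]
    push_cast
    linarith

theorem summable_pow_mul_iterSubGreenOp {f : ℝ → ℝ} (hf : Continuous f) {x : ℝ}
    (hx : x ∈ Set.Icc (0 : ℝ) 1) {q : ℝ} (hq₀ : 0 ≤ q) (hq₁ : q < 1) :
    Summable fun n : ℕ => q ^ n * iterSubGreenOp f n x := by
  have h₁ : Summable fun n : ℕ => q ^ n := summable_geometric_of_lt_one hq₀ hq₁
  have h₂ : Summable fun n : ℕ => (n : ℝ) ^ 1 * q ^ n :=
    summable_pow_mul_geometric_of_norm_lt_one 1 (by rwa [Real.norm_of_nonneg hq₀])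
  refine Summable.of_norm_bounded
    ((h₁.mul_left |f x|).add (h₂.mul_left (1 + ∫ t in (0 : ℝ)..1, f t ^ 2))) fun n => ?_
  rw [Real.norm_eq_abs, abs_mul, abs_of_nonneg (pow_nonneg hq₀ n)]
  have h := mul_le_mul_of_nonneg_left (abs_iterSubGreenOp_le hf hx n) (pow_nonneg hq₀ n)
  linarith

theorem greenOp_id (x : ℝ) : greenOp (fun t => t) x = 1 / 6 * x * (1 - x ^ 2) := by
  have h : ∀ y : ℝ, ∫ t in (0 : ℝ)..y, t * t = y ^ 3 / 3 := fun y => by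
    simp only [← pow_two, integral_pow]
    norm_num
  simp only [greenOp, h, integral_id]
  ring

theorem greenOp_sinh {s : ℝ} (hs : 0 < s) (x : ℝ) :
    greenOp (fun t => Real.sinh (t * s) / Real.sinh s) x
      = (x - Real.sinh (x * s) / Real.sinh s) / s ^ 2 := by
  have hsinh : Real.sinh s ≠ 0 := (Real.sinh_pos_iff.2 hs).ne'
  have hmul : ∀ y : ℝ, HasDerivAt (fun t : ℝ => t * s) s y := fun y => by
    simpa using (hasDerivAt_id y).mul_const s
  have h₁ : ∀ y : ℝ, ∫ t in (0 : ℝ)..y, Real.sinh (t * s) / Real.sinh s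
      = (Real.cosh (y * s) - 1) / (s * Real.sinh s) := fun y => by
    rw [intervalIntegral.integral_eq_sub_of_hasDerivAt
      (f := fun t => Real.cosh (t * s) / (s * Real.sinh s))
      (fun t _ => ((hmul t).cosh.div_const _).congr_deriv (by field_simp))
      (Continuous.intervalIntegrable (by fun_prop) 0 y)]
    simp
    ring
  have h₂ : ∀ y : ℝ, ∫ t in (0 : ℝ)..y, t * (Real.sinh (t * s) / Real.sinh s)
      = (y * s * Real.cosh (y * s) - Real.sinh (y * s)) / (s ^ 2 * Real.sinh s) := fun y => by
    rw [intervalIntegral.integral_eq_sub_of_hasDerivAt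
      (f := fun t => (t * s * Real.cosh (t * s) - Real.sinh (t * s)) / (s ^ 2 * Real.sinh s))
      (fun t _ => ((((hmul t).mul (hmul t).cosh).sub (hmul t).sinh).div_const _).congr_deriv
        (by field_simp; ring))
      (Continuous.intervalIntegrable (by fun_prop) 0 y)]
    simp
  simp only [greenOp, h₁, h₂, one_mul]
  field_simp
  ring

/-- Scalar form of the Cayley transform series representation (4) of the paper:
for `λ > 0` and `x ∈ [0,1]`,
`sinh(x√λ)/sinh(√λ) = Σ_{k=0}^∞ v_k(x) (λ/(1+λ))^k`, converging absolutely. -/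
theorem sinh_ratio_cayley_series (v : ℕ → ℝ → ℝ)
    (hv0 : ∀ x ∈ Set.Icc (0 : ℝ) 1, v 0 x = x)
    (hv1 : ∀ x ∈ Set.Icc (0 : ℝ) 1, v 1 x = -(1 / 6) * x * (1 - x ^ 2))
    (hrec : ∀ k, 2 ≤ k → ∀ x ∈ Set.Icc (0 : ℝ) 1,
      v k x = v (k - 1) x - ∫ ξ in (0 : ℝ)..1, G0 x ξ * v (k - 1) ξ)
    (lam : ℝ) (hlam : 0 < lam) (x : ℝ) (hx : x ∈ Set.Icc (0 : ℝ) 1) :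
    Summable (fun k : ℕ => |v k x * (lam / (1 + lam)) ^ k|) ∧
    Real.sinh (x * Real.sqrt lam) / Real.sinh (Real.sqrt lam)
      = ∑' k : ℕ, v k x * (lam / (1 + lam)) ^ k := by
  set q := lam / (1 + lam) with hq
  have hq_pos : 0 < q := by positivity
  have hq_lt : q < 1 := by rw [hq, div_lt_one (by positivity)]; linarith
  have hq_lam : (1 - q) * lam = q := by rw [hq]; field_simp; ring
  clear_value q
  set s := Real.sqrt lam with hs
  have hs_pos : 0 < s := Real.sqrt_pos.2 hlam
  have hs_sq : s ^ 2 = lam := Real.sq_sqrt hlam.le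
  set u : ℝ → ℝ := fun t => Real.sinh (t * s) / Real.sinh s with hu
  have hu_cont : Continuous u := by fun_prop
  have hu_green : ∀ y, lam * greenOp u y = y - u y := fun y => by
    rw [hu, greenOp_sinh hs_pos, hs_sq]
    field_simp
  set f : ℝ → ℝ := fun t => 1 * u t + (-1) * t with hf
  have hf_cont : Continuous f := by fun_prop
  have hf_green : ∀ y, greenOp f y = 1 * greenOp u y + (-1) * (1 / 6 * y * (1 - y ^ 2)) :=
    fun y => by rw [hf, greenOp_linear hu_cont continuous_id', greenOp_id]
  set r := iterSubGreenOp f with hr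
  have hr_cont : ∀ k, Continuous (r k) := continuous_iterSubGreenOp hf_cont
  have hr_succ : ∀ k y, r (k + 1) y = r k y - greenOp (r k) y := fun k y => rfl
  have hv : ∀ k, ∀ y ∈ Set.Icc (0 : ℝ) 1, v (k + 1) y = q⁻¹ * r k y + (-1) * r (k + 1) y := by
    intro k
    induction k with
    | zero =>
      intro y hy
      have h₀ : r 0 y = 1 * u y + (-1) * y := rfl
      have h₁ : greenOp (r 0) y = greenOp f y := rfl
      rw [hv1 y hy, hr_succ, h₁, hf_green, h₀]
      refine mul_left_cancel₀ hq_pos.ne' ?_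
      linear_combination -(1 - q) * hu_green y + greenOp u y * hq_lam
        - (1 * u y + (-1) * y) * mul_inv_cancel₀ hq_pos.ne'
    | succ k ih =>
      intro y hy
      have h : ∫ t in (0 : ℝ)..1, G0 y t * v (k + 1) t
          = greenOp (fun t => q⁻¹ * r k t + (-1) * r (k + 1) t) y := by
        have hr₀ := hr_cont k
        have hr₁ := hr_cont (k + 1)
        rw [← integral_G0_mul (by fun_prop) hy]
        refine intervalIntegral.integral_congr fun t ht => ?_
        rw [Set.uIcc_of_le zero_le_one] at ht
        simp only [ih t ht]
      rw [hrec (k + 1 + 1) (by omega) y hy, Nat.add_sub_cancel, h,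
        greenOp_linear (hr_cont k) (hr_cont (k + 1)), ih y hy, hr_succ (k + 1) y, hr_succ k y]
      ring
  have hsum : Summable fun k => q ^ k * r k x :=
    summable_pow_mul_iterSubGreenOp hf_cont hx hq_pos.le hq_lt
  have hterm : ∀ k, v (k + 1) x * q ^ (k + 1) = q ^ k * r k x - q ^ (k + 1) * r (k + 1) x :=
    fun k => by
      rw [hv k x hx]
      field_simp
      ring
  have hsum_succ : Summable fun k => q ^ (k + 1) * r (k + 1) x :=
    (summable_nat_add_iff (f := fun k => q ^ k * r k x) 1).2 hsum
  have hsum_v : Summable fun k => v k x * q ^ k := by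
    rw [← summable_nat_add_iff 1]
    simpa only [hterm] using hsum.sub hsum_succ
  refine ⟨hsum_v.abs, ?_⟩
  rw [hsum_v.tsum_eq_zero_add]
  simp only [hterm]
  rw [hsum.tsum_sub hsum_succ, hsum.tsum_eq_zero_add, hv0 x hx]
  have h₀ : r 0 x = 1 * u x + (-1) * x := rfl
  rw [h₀]
  simp only [hu]
  ring
end
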